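/- Let n ≥ 2 be an integer and let A be a 2-torsion-free unital ring containing a nontrivial idempotent e₁ (e₁ ≠ 0 and e₁ ≠ 1), write e₂ = 1 − e₁. Assume e₁Ae₂·e₂Ae₁ = {0} = e₂Ae₁·e₁Ae₂, that e₁Ae₂ is faithful as a left e₁Ae₁-module (e₁te₁·e₁Ae₂ = {0} implies e₁te₁ = 0) and faithful as a right e₂Ae₂-module (e₁Ae₂·e₂te₂ = {0} implies e₂te₂ = 0). Then every multiplicative generalized Jordan n-derivation Δ : A → A is of the form Δ(t) = μt + d(t) + φ(t) for all t ∈ A, where μ lies in the center Z(A), d : A → A is a derivation, and φ : A → A is an antiderivation. -/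

import Mathlib

/-- The Jordan `n`-product `qₙ(t₁,…,tₙ)`, folding the Jordan product `a∘b = ab + ba`
from the left: `q₁(t₁) = t₁`, `qₙ(t₁,…,tₙ) = qₙ₋₁(t₁,…,tₙ₋₁)∘tₙ`. -/
def jordanProd {A : Type*} [Ring A] : List A → A
  | [] => 0
  | t :: ts => ts.foldl (fun x y => x * y + y * x) t

/-- A map `δ` (not assumed additive) is a multiplicative Jordan `n`-derivation if
`δ(qₙ(t₁,…,tₙ)) = Σᵢ qₙ(t₁,…,δ(tᵢ),…,tₙ)` for all `t₁,…,tₙ`. -/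
def IsMulJordanDeriv {A : Type*} [Ring A] (n : ℕ) (δ : A → A) : Prop :=
  ∀ l : List A, l.length = n →
    δ (jordanProd l) = ∑ i ∈ Finset.range n, jordanProd (l.set i (δ (l.getD i 0)))

/-- A map `Δ` is a multiplicative generalized Jordan `n`-derivation (with associated
multiplicative Jordan `n`-derivation `δ`). -/
def IsMulGenJordanDeriv {A : Type*} [Ring A] (n : ℕ) (Δ δ : A → A) : Prop :=
  ∀ l : List A, l.length = n →
    Δ (jordanProd l) = jordanProd (l.set 0 (Δ (l.getD 0 0)))
      + ∑ i ∈ Finset.Ico 1 n, jordanProd (l.set i (δ (l.getD i 0)))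


section JordanFold

variable {A : Type*} [Ring A]

theorem foldl_jordan_replicate_one (k : ℕ) (z : A) :
    (List.replicate k 1).foldl (fun x y => x * y + y * x) z = 2 ^ k * z := by
  induction k generalizing z with
  | zero => simp
  | succ k ih =>
    rw [List.replicate_succ, List.foldl_cons, ih, pow_succ, mul_assoc]
    simp [two_mul]

theorem two_mul_foldl_jordan_replicate_one_set (k i : ℕ) (hi : i < k) (z c : A) :
    2 * ((List.replicate k 1).set i c).foldl (fun x y => x * y + y * x) z
      = 2 ^ k * (z * c + c * z) := by
  induction k generalizing z i with
  | zero => omega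
  | succ k ih =>
    rw [List.replicate_succ]
    cases i with
    | zero =>
      rw [List.set_cons_zero, List.foldl_cons, foldl_jordan_replicate_one, pow_succ', mul_assoc]
    | succ i =>
      rw [List.set_cons_succ, List.foldl_cons, ih i (by omega), pow_succ, mul_assoc]
      congr 1
      noncomm_ring

theorem IsMulJordanDeriv.isMulGenJordanDeriv {n : ℕ} (hn : 2 ≤ n) {δ : A → A}
    (h : IsMulJordanDeriv n δ) : IsMulGenJordanDeriv n δ δ := by
  intro l hl
  rw [h l hl, Finset.range_eq_Ico, Finset.sum_eq_sum_Ico_succ_bot (by omega)]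

theorem IsMulGenJordanDeriv.two_mul_map {k : ℕ} {Δ δ : A → A}
    (h : IsMulGenJordanDeriv (k + 2) Δ δ) (x y : A) :
    2 * Δ (2 ^ k * (x * y + y * x)) =
      2 ^ k * (2 * (Δ x * y + y * Δ x) + 2 * (x * δ y + δ y * x)
        + k * ((x * y + y * x) * δ 1 + δ 1 * (x * y + y * x))) := by
  have key := h (x :: y :: List.replicate k 1) (by simp)
  rw [Finset.sum_eq_sum_Ico_succ_bot (by omega), Finset.sum_Ico_eq_sum_range] at key
  have hsum : 2 * ∑ i ∈ Finset.range (k + 2 - (1 + 1)),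
      jordanProd ((x :: y :: List.replicate k 1).set (1 + 1 + i)
        (δ ((x :: y :: List.replicate k 1).getD (1 + 1 + i) 0)))
      = k * (2 ^ k * ((x * y + y * x) * δ 1 + δ 1 * (x * y + y * x))) := by
    rw [Finset.mul_sum, Finset.sum_congr rfl (g := fun _ =>
      2 ^ k * ((x * y + y * x) * δ 1 + δ 1 * (x * y + y * x)))]
    · simp
    · intro i hi
      have hi : i < k := by simpa using hi
      rw [show 1 + 1 + i = i + 1 + 1 by omega, List.set_cons_succ, List.set_cons_succ,
        List.getD_cons_succ, List.getD_cons_succ, List.getD_eq_getElem _ _ (by simpa using hi),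
        List.getElem_replicate]
      exact two_mul_foldl_jordan_replicate_one_set k i hi _ _
  have key := congrArg (fun z => 2 * z) key
  simp only [mul_add (2 : A)] at key
  rw [hsum] at key
  simp only [jordanProd, List.foldl_cons, List.set_cons_zero, List.getD_cons_zero,
    List.set_cons_succ, List.getD_cons_succ, foldl_jordan_replicate_one] at key
  rw [key]
  have hk : (k : A) * 2 ^ k = 2 ^ k * k := (Nat.cast_commute k _).eq
  rw [← mul_assoc (k : A), hk]
  have h2k : (2 : A) * 2 ^ k = 2 ^ k * 2 := by rw [← pow_succ, pow_succ']
  simp only [← mul_assoc (2 : A), h2k]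
  simp only [mul_assoc, mul_add, add_assoc]

end JordanFold

theorem map_two_mul_of_jordan {A : Type*} [Ring A] {D : A → A}
    (hD : ∀ x y, D (x * y + y * x) = D x * y + y * D x + (x * D y + D y * x)) (D1 : D 1 = 0)
    (x : A) : D (2 * x) = 2 * D x := by
  have := hD x 1
  rw [mul_one, one_mul, D1, ← two_mul] at this
  linear_combination (norm := noncomm_ring) this

/-- Complementary idempotents `e`, `f` in a 2-torsion free ring whose off-diagonal Peirce
components annihilate each other, with `eAf` faithful on both sides. -/
structure TrivialMoritaPair {A : Type*} [Ring A] (e f : A) : Prop where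
  eq_zero_of_two_mul : ∀ t : A, 2 * t = 0 → t = 0
  add_eq_one : e + f = 1
  left_idem : e * e = e
  efe : ∀ x y : A, e * x * f * (f * y * e) = 0
  fef : ∀ x y : A, f * x * e * (e * y * f) = 0
  faithful_left : ∀ t : A, (∀ a : A, e * t * e * (e * a * f) = 0) → e * t * e = 0
  faithful_right : ∀ t : A, (∀ a : A, e * a * f * (f * t * f) = 0) → f * t * f = 0

namespace TrivialMoritaPair

variable {A : Type*} [Ring A] {e f : A} (h : TrivialMoritaPair e f)
include h

theorem eq_of_two_mul {a b : A} (hab : 2 * a = 2 * b) : a = b :=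
  sub_eq_zero.1 (h.eq_zero_of_two_mul _ (by rw [mul_sub, hab, sub_self]))

theorem mul_right_comp (x : A) : x * f = x - x * e := by
  rw [eq_sub_iff_add_eq', ← mul_add, h.add_eq_one, mul_one]

theorem mul_left_comp (x : A) : f * x = x - e * x := by
  rw [eq_sub_iff_add_eq', ← add_mul, h.add_eq_one, one_mul]

theorem left_idem_assoc (x : A) : e * (e * x) = e * x := by
  rw [← mul_assoc, h.left_idem]

theorem eq_zero_of_mul_offDiag {t : A} (h₁ : e * t = t) (h₂ : t * e = t)
    (ht : ∀ m, e * m = m → m * e = 0 → t * m = 0) : t = 0 := by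
  have := h.faithful_left t fun a => by
    rw [h₁, h₂]
    refine ht _ ?_ ?_
    · simp only [← mul_assoc, h.left_idem]
    · simp only [h.mul_right_comp, sub_mul, mul_assoc, h.left_idem, sub_self]
  rwa [h₁, h₂] at this

theorem eq_zero_of_offDiag_mul {t : A} (h₁ : e * t = 0) (h₂ : t * e = 0)
    (ht : ∀ m, e * m = m → m * e = 0 → m * t = 0) : t = 0 := by
  have key : f * t * f = t := by
    simp only [h.mul_right_comp, h.mul_left_comp, h₁, h₂, sub_zero]
  have := h.faithful_right t fun a => by
    rw [key]
    refine ht _ ?_ ?_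
    · simp only [← mul_assoc, h.left_idem]
    · simp only [h.mul_right_comp, sub_mul, mul_assoc, h.left_idem, sub_self]
  rwa [key] at this

theorem offDiag_mul_offDiag {v w : A} (hv : e * v + v * e = v) (hw : e * w + w * e = w) :
    v * w = 0 := by
  have corner : ∀ {v : A}, e * v + v * e = v → e * v * e = 0 := fun {v} hv => by
    have := congrArg (fun z => e * z) hv
    simpa [mul_add, h.left_idem_assoc, mul_assoc] using this
  have decomp : ∀ {v : A}, e * v + v * e = v → v = e * v * f + f * v * e := fun {v} hv => by
    conv_lhs => rw [← hv]
    simp only [h.mul_right_comp, h.mul_left_comp, sub_mul, corner hv, sub_zero]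
  have h₁ := h.efe v w
  have h₂ := h.fef v w
  have hfe : f * e = 0 := by rw [h.mul_left_comp, h.left_idem, sub_self]
  have hef : e * f = 0 := by rw [h.mul_right_comp, h.left_idem, sub_self]
  rw [decomp hv, decomp hw, mul_add, add_mul, add_mul, h₁, h₂]
  have h₃ : e * v * f * (e * w * f) = e * v * (f * e) * w * f := by noncomm_ring
  have h₄ : f * v * e * (f * w * e) = f * v * (e * f) * w * e := by noncomm_ring
  simp [h₃, h₄, hef, hfe]

theorem central_of_commute_offDiag {s : A} (hs : s * e = e * s)
    (hm : ∀ m, e * m = m → m * e = 0 → s * m = m * s)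
    (hn : ∀ n, e * n = 0 → n * e = n → s * n = n * s) (x : A) : s * x = x * s := by
  have hse (y : A) : s * (e * y) = e * (s * y) := by rw [← mul_assoc, hs, mul_assoc]
  have ee := h.left_idem
  have ee' := h.left_idem_assoc
  have c₁ := hm (e * x - e * x * e) (by simp [mul_sub, mul_assoc, ee'])
    (by simp [sub_mul, mul_assoc, ee])
  have c₂ := hn (x * e - e * x * e) (by simp [mul_sub, mul_assoc, ee'])
    (by simp [sub_mul, mul_assoc, ee])
  have c₃ : s * (e * x * e) - e * x * e * s = 0 := by
    refine h.eq_zero_of_mul_offDiag ?_ ?_ fun m m₁ m₂ => ?_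
    · simp only [mul_sub, mul_assoc, hse, ee']
    · simp only [sub_mul, mul_assoc, hs, ee, ee']
    · have a₁ := hm (e * x * e * m) (by simp [mul_assoc, ee']) (by simp [mul_assoc, m₂])
      have a₂ := hm m m₁ m₂
      rw [sub_mul, mul_assoc s, a₁, mul_assoc _ s, a₂]
      noncomm_ring
  have c₄ : s * (x - e * x - x * e + e * x * e) - (x - e * x - x * e + e * x * e) * s = 0 := by
    refine h.eq_zero_of_offDiag_mul ?_ ?_ fun m m₁ m₂ => ?_
    · simp only [mul_sub, mul_add, sub_mul, add_mul, mul_assoc, hse, ee']; abel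
    · simp only [mul_sub, mul_add, sub_mul, add_mul, mul_assoc, hs, ee, ee']; abel
    · set b := x - e * x - x * e + e * x * e with hb
      have a₁ := hm (m * b) (by rw [← mul_assoc, m₁]) (by
        rw [mul_assoc, hb]; simp only [sub_mul, add_mul, mul_assoc, ee]; simp)
      have a₂ := hm m m₁ m₂
      rw [mul_sub, ← mul_assoc, ← a₂, mul_assoc, a₁]
      noncomm_ring
  linear_combination (norm := noncomm_ring) c₁ + c₂ + c₃ + c₄

theorem central_of_jordan_assoc {s : A}
    (hs : ∀ x y, (s * x + x * s) * y + y * (s * x + x * s)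
      = s * (x * y + y * x) + (x * y + y * x) * s) (x : A) : s * x = x * s := by
  have hc (x y : A) : x * (s * y - y * s) = (s * y - y * s) * x := by
    linear_combination (norm := noncomm_ring) hs x y
  have ee := h.left_idem
  have ee' := h.left_idem_assoc
  have hse : s * e = e * s := by
    have k := hc e e
    have k₁ := congrArg (fun z => e * z) k
    have k₂ := congrArg (fun z => z * e) k
    simp only [mul_sub, sub_mul, mul_assoc, ee, ee'] at k k₁ k₂
    linear_combination (norm := noncomm_ring) k₁ - k₂
  refine h.central_of_commute_offDiag hse (fun m m₁ m₂ => ?_) (fun n n₁ n₂ => ?_) x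
  · have k := hc e m
    rw [mul_sub, sub_mul, ← mul_assoc, ← hse, mul_assoc, m₁, mul_assoc s, m₂, mul_assoc m, hse,
      ← mul_assoc m, m₂, ← mul_assoc, m₁] at k
    simpa [sub_eq_zero] using k
  · have k := hc e n
    rw [mul_sub, sub_mul, ← mul_assoc, ← hse, mul_assoc, n₁, mul_assoc s, n₂, mul_assoc n, hse,
      ← mul_assoc n, n₂, ← mul_assoc, n₁] at k
    simpa [sub_eq_zero, eq_comm] using k

theorem two_mul_map_jordan {k : ℕ} {Δ δ : A → A} (hΔ : IsMulGenJordanDeriv (k + 2) Δ δ)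
    (x y : A) : 2 * Δ (x * y + y * x)
        + ((x * y + y * x) * δ 1 + δ 1 * (x * y + y * x))
      = 2 * (Δ x * y + y * Δ x) + (x * δ (2 * y) + δ (2 * y) * x) := by
  have cancel : ∀ (j : ℕ) {a b : A}, 2 ^ j * a = 2 ^ j * b → a = b := fun j => by
    induction j with
    | zero => simp
    | succ j ih => exact fun hab => ih (h.eq_of_two_mul (by simpa [pow_succ', mul_assoc] using hab))
  have h₁ := hΔ.two_mul_map x (2 * y)
  have h₂ := hΔ.two_mul_map (x * y + y * x) 1
  rw [show x * (2 * y) + 2 * y * x = (x * y + y * x) * 1 + 1 * (x * y + y * x) by noncomm_ring,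
    h₂] at h₁
  have h₃ := cancel k h₁
  refine h.eq_of_two_mul ?_
  linear_combination (norm := noncomm_ring) h₃

theorem central_and_map_two_mul {δ : A → A} {c : A}
    (hδ : ∀ x y, 2 * δ (x * y + y * x) + ((x * y + y * x) * c + c * (x * y + y * x))
      = 2 * (δ x * y + y * δ x) + (x * δ (2 * y) + δ (2 * y) * x)) :
    (∀ x, c * x = x * c) ∧ ∀ x, δ (2 * x) = 2 * δ x := by
  obtain ⟨g, hg⟩ : ∃ g, g = δ (2 * 1) - 2 * c := ⟨_, rfl⟩
  have hdouble (x : A) : 2 * δ (2 * x) = 4 * δ x + (g * x + x * g) := by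
    have := hδ x 1
    rw [mul_one, one_mul, ← two_mul x] at this
    rw [hg]
    linear_combination (norm := noncomm_ring) this
  have hprod (x y : A) : 4 * δ (x * y + y * x) = 4 * (δ x * y + y * δ x)
      + 4 * (x * δ y + δ y * x) + (x * (g * y + y * g) + (g * y + y * g) * x)
      - 2 * ((x * y + y * x) * c + c * (x * y + y * x)) := by
    have h₁ := hδ x y
    have h₂ := hdouble y
    linear_combination (norm := noncomm_ring) 2 * h₁ + x * h₂ + h₂ * x
  have hgc : ∀ x, g * x = x * g := by
    refine h.central_of_jordan_assoc fun y x => ?_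
    have h₁ := hprod x (2 * y)
    have h₂ := hdouble (x * y + y * x)
    have h₃ := hprod x y
    have h₄ := hdouble y
    rw [show x * (2 * y) + 2 * y * x = 2 * (x * y + y * x) by noncomm_ring] at h₁
    refine h.eq_of_two_mul (h.eq_of_two_mul ?_)
    linear_combination (norm := noncomm_ring)
      4 * h₂ + 4 * h₃ - 2 * h₁ - 4 * (x * h₄) - 4 * h₄ * x
  have hprod' (x y : A) : 2 * δ (x * y + y * x) = 2 * (δ x * y + y * δ x)
      + 2 * (x * δ y + δ y * x) + g * (x * y + y * x)
      - ((x * y + y * x) * c + c * (x * y + y * x)) := by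
    refine h.eq_of_two_mul ?_
    have h₁ := hgc x
    have h₂ := hgc y
    linear_combination (norm := noncomm_ring) hprod x y - x * h₂ - h₂ * x - 2 * (h₁ * y)
  have hidem (p : A) (hp : p * p = p) : 2 * δ p = 2 * (δ p * p + p * δ p) - (p * c + c * p) := by
    have h₁ := hprod' p p
    have h₂ := hdouble p
    rw [hp, ← two_mul] at h₁
    refine h.eq_of_two_mul ?_
    linear_combination (norm := noncomm_ring) h₁ - h₂ + hgc p
  have hcomm (p : A) (hp : p * p = p) : c * p = p * c := by
    have hp' (z : A) : p * (p * z) = p * z := by rw [← mul_assoc, hp]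
    have k₁ := congrArg (fun z => p * z) (hidem p hp)
    have k₂ := congrArg (fun z => z * p) (hidem p hp)
    simp only [two_mul, mul_add, add_mul, mul_sub, sub_mul, mul_assoc, hp, hp'] at k₁ k₂
    linear_combination (norm := noncomm_ring) k₂ - k₁
  have hleft (p m : A) (hp : p * p = p) (m₁ : p * m = m) (m₂ : m * p = 0) :
      c * m - m * c + g * m = 0 := by
    have hp' (z : A) : p * (p * z) = p * z := by rw [← mul_assoc, hp]
    have m₁' (z : A) : p * (m * z) = m * z := by rw [← mul_assoc, m₁]
    have m₂' (z : A) : m * (p * z) = 0 := by rw [← mul_assoc, m₂, zero_mul]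
    have hc := hcomm p hp
    have hc' (z : A) : p * (c * z) = c * (p * z) := by rw [← mul_assoc, ← hc, mul_assoc]
    have hg' (z : A) : p * (g * z) = g * (p * z) := by rw [← mul_assoc, ← hgc, mul_assoc]
    have k₁ := congrArg (fun z => p * z * m) (hidem p hp)
    have k₂ := congrArg (fun z => m * z * (1 - p)) (hidem p hp)
    have k₃ := hprod' p m
    rw [m₁, m₂, add_zero] at k₃
    replace k₃ := congrArg (fun z => p * z * (1 - p)) k₃
    simp only [two_mul, mul_add, add_mul, mul_sub, sub_mul, mul_assoc, hp, hp', m₁, m₂, m₁', m₂',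
      hc, hc', hg', mul_one, mul_zero, sub_zero, add_zero, zero_add] at k₁ k₂ k₃
    linear_combination (norm := noncomm_ring) k₁ - k₂ - k₃
  have hright (p m : A) (hp : p * p = p) (m₁ : p * m = 0) (m₂ : m * p = m) :
      m * c - c * m + g * m = 0 := by
    have hp' (z : A) : p * (p * z) = p * z := by rw [← mul_assoc, hp]
    have m₁' (z : A) : p * (m * z) = 0 := by rw [← mul_assoc, m₁, zero_mul]
    have m₂' (z : A) : m * (p * z) = m * z := by rw [← mul_assoc, m₂]
    have hc := hcomm p hp
    have hc' (z : A) : p * (c * z) = c * (p * z) := by rw [← mul_assoc, ← hc, mul_assoc]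
    have hg' (z : A) : p * (g * z) = g * (p * z) := by rw [← mul_assoc, ← hgc, mul_assoc]
    have k₁ := congrArg (fun z => m * z * p) (hidem p hp)
    have k₂ := congrArg (fun z => (1 - p) * z * m) (hidem p hp)
    have k₃ := hprod' p m
    rw [m₁, m₂, zero_add] at k₃
    replace k₃ := congrArg (fun z => (1 - p) * z * p) k₃
    simp only [two_mul, mul_add, add_mul, mul_sub, sub_mul, mul_assoc, hp, hp', m₁, m₂, m₁', m₂',
      hc, hc', hg', one_mul, mul_zero, sub_zero, add_zero, zero_add] at k₁ k₂ k₃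
    linear_combination (norm := noncomm_ring) k₁ - k₂ - k₃
  have hff : f * f = f := by
    rw [h.mul_left_comp, h.mul_right_comp, h.left_idem, sub_self, sub_zero]
  have hM (m : A) (m₁ : e * m = m) (m₂ : m * e = 0) : g * m = 0 ∧ c * m = m * c := by
    have k₁ := hleft e m h.left_idem m₁ m₂
    have k₂ := hright f m hff (by rw [h.mul_left_comp, m₁, sub_self])
      (by rw [h.mul_right_comp, m₂, sub_zero])
    have k₃ : g * m = 0 :=
      h.eq_zero_of_two_mul _ (by linear_combination (norm := noncomm_ring) k₁ + k₂)
    rw [k₃, add_zero, sub_eq_zero] at k₁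
    exact ⟨k₃, k₁⟩
  have hN (m : A) (m₁ : e * m = 0) (m₂ : m * e = m) : c * m = m * c := by
    have k₁ := hright e m h.left_idem m₁ m₂
    have k₂ := hleft f m hff (by rw [h.mul_left_comp, m₁, sub_zero])
      (by rw [h.mul_right_comp, m₂, sub_self])
    refine h.eq_of_two_mul ?_
    linear_combination (norm := noncomm_ring) k₂ - k₁
  have hg0 : g = 0 := by
    have h₁ : g * e = 0 := h.eq_zero_of_mul_offDiag (by rw [hgc, ← mul_assoc, h.left_idem])
      (by rw [mul_assoc, h.left_idem]) fun m m₁ m₂ => by rw [mul_assoc, m₁, (hM m m₁ m₂).1]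
    refine h.eq_zero_of_offDiag_mul (by rw [← hgc, h₁]) h₁ fun m m₁ m₂ => ?_
    rw [← hgc, (hM m m₁ m₂).1]
  refine ⟨h.central_of_commute_offDiag (hcomm e h.left_idem) (fun m m₁ m₂ => (hM m m₁ m₂).2) hN,
    fun x => h.eq_of_two_mul ?_⟩
  rw [hdouble, hg0]
  noncomm_ring

theorem exists_central_of_isMulJordanDeriv {k : ℕ} {δ : A → A}
    (hδ : IsMulJordanDeriv (k + 2) δ) :
    ∃ c, (∀ x, c * x = x * c) ∧ ∃ D : A → A, D 1 = 0 ∧ (∀ x, δ x = c * x + D x) ∧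
      ∀ x y, D (x * y + y * x) = D x * y + y * D x + (x * D y + D y * x) := by
  have hE := h.two_mul_map_jordan (hδ.isMulGenJordanDeriv (by omega))
  obtain ⟨hc, htwo⟩ := h.central_and_map_two_mul hE
  refine ⟨δ 1, hc, fun x => δ x - δ 1 * x, by simp, by simp, fun x y => h.eq_of_two_mul ?_⟩
  have h₁ := hE x y
  rw [htwo] at h₁
  linear_combination (norm := noncomm_ring)
    h₁ + hc (x * y) + hc (y * x) - 2 * (hc x * y) - 2 * (hc y * x)

theorem exists_central_of_isMulGenJordanDeriv {k : ℕ} {Δ δ : A → A}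
    (hΔ : IsMulGenJordanDeriv (k + 2) Δ δ) (hδ : IsMulJordanDeriv (k + 2) δ) :
    ∃ s, (∀ x, s * x = x * s) ∧ ∀ x, Δ x = s * x + δ x := by
  have h₁ := h.two_mul_map_jordan hΔ
  have h₂ := h.two_mul_map_jordan (hδ.isMulGenJordanDeriv (by omega))
  obtain ⟨S, hS⟩ : ∃ S : A → A, ∀ x, S x = Δ x - δ x := ⟨_, fun _ => rfl⟩
  have hmul (x y : A) : S (x * y + y * x) = S x * y + y * S x := by
    refine h.eq_of_two_mul ?_
    simp only [hS]
    linear_combination (norm := noncomm_ring) h₁ x y - h₂ x y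
  have hone (x : A) : 2 * S x = S 1 * x + x * S 1 := by
    have k₁ := hmul x 1
    have k₂ := hmul 1 x
    rw [mul_one, one_mul] at k₁ k₂
    linear_combination (norm := noncomm_ring) k₂ - k₁
  have hc := h.central_of_jordan_assoc (s := S 1) fun x y => by
    linear_combination (norm := noncomm_ring)
      hone (x * y + y * x) - hone x * y - y * hone x - 2 * hmul x y
  refine ⟨S 1, hc, fun x => h.eq_of_two_mul ?_⟩
  have := hone x
  rw [hS x] at this
  linear_combination (norm := noncomm_ring) this - hc x

section JordanMap

variable {D : A → A}
  (hD : ∀ x y, D (x * y + y * x) = D x * y + y * D x + (x * D y + D y * x))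

include hD in
theorem exists_map_sub_commutator_eq_zero (D1 : D 1 = 0) :
    ∃ w, D e - (e * w - w * e) = 0 := by
  have ee := h.left_idem
  have ee' := h.left_idem_assoc
  have k := hD e e
  rw [ee, ← two_mul, map_two_mul_of_jordan hD D1] at k
  replace k : D e = D e * e + e * D e := h.eq_of_two_mul (by
    linear_combination (norm := noncomm_ring) k)
  have k' := congrArg (fun z => e * z) k
  refine ⟨e * D e - D e * e, ?_⟩
  simp only [mul_add, mul_sub, sub_mul, mul_assoc, ee, ee'] at k' ⊢
  linear_combination (norm := noncomm_ring) k - 2 * k'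

variable (De : D e = 0)
include hD De

theorem map_compl_of_jordan (D1 : D 1 = 0) : D f = 0 := by
  have hef : e * f = 0 := by rw [h.mul_right_comp, h.left_idem, sub_self]
  have hfe : f * e = 0 := by rw [h.mul_left_comp, h.left_idem, sub_self]
  have hff : f * f = f := by rw [h.mul_left_comp, hef, sub_zero]
  have D0 : D 0 = 0 := by simpa using hD 0 0
  have k₁ := hD e f
  have k₂ := hD f f
  rw [hef, hfe, De, add_zero, D0] at k₁
  rw [hff, ← two_mul, map_two_mul_of_jordan hD D1] at k₂
  replace k₂ : D f = D f * f + f * D f := h.eq_of_two_mul (by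
    linear_combination (norm := noncomm_ring) k₂)
  simp only [h.mul_right_comp, h.mul_left_comp] at k₂
  linear_combination (norm := noncomm_ring) - k₂ - k₁

theorem peirce_left_of_jordan (D1 : D 1 = 0) {a : A} (h₁ : e * a = a) (h₂ : a * e = a) :
    e * D a = D a ∧ D a * e = D a := by
  have ee' := h.left_idem_assoc
  have k := hD e a
  rw [h₁, h₂, De, ← two_mul, map_two_mul_of_jordan hD D1] at k
  have k₁ := congrArg (fun z => e * z) k
  have k₂ := congrArg (fun z => z * e) k
  simp only [two_mul, mul_add, add_mul, mul_assoc, h.left_idem, ee'] at k₁ k₂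
  refine ⟨h.eq_of_two_mul ?_, h.eq_of_two_mul ?_⟩
  · linear_combination (norm := noncomm_ring) - k + k₁ - k₂
  · linear_combination (norm := noncomm_ring) - k - k₁ + k₂

omit h in
theorem peirce_offDiag_of_jordan {w : A} (hw : e * w + w * e = w) :
    e * D w + D w * e = D w := by
  have k := hD e w
  rw [hw, De] at k
  linear_combination (norm := noncomm_ring) - k

theorem peirce_right_of_jordan {b : A} (h₁ : e * b = 0) (h₂ : b * e = 0) :
    e * D b = 0 ∧ D b * e = 0 := by
  have D0 : D 0 = 0 := by simpa using hD 0 0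
  have k := hD e b
  rw [h₁, h₂, De, add_zero, D0] at k
  have k₁ := congrArg (fun z => e * z) k
  have k₂ := congrArg (fun z => z * e) k
  simp only [mul_add, add_mul, mul_assoc, h.left_idem, h.left_idem_assoc, mul_zero, zero_mul]
    at k₁ k₂
  refine ⟨h.eq_of_two_mul ?_, h.eq_of_two_mul ?_⟩
  · linear_combination (norm := noncomm_ring) - k - k₁ + k₂
  · linear_combination (norm := noncomm_ring) - k + k₁ - k₂

theorem map_peirce_of_jordan (D1 : D 1 = 0) (x : A) :
    D (e * x * e) = e * D x * e ∧ D (f * x * f) = f * D x * f ∧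
      D (e * x * f + f * x * e) = e * D x * f + f * D x * e := by
  have ee := h.left_idem
  have Df := h.map_compl_of_jordan hD De D1
  have two := map_two_mul_of_jordan hD D1
  have D2 : D (2 * 1) = 0 := by rw [two, D1, mul_zero]
  have hf : f = 1 - e := by rw [← h.add_eq_one]; abel
  subst hf
  have Du : D (2 * e - 1) = 0 := by
    have k₁ := hD (2 * e - 1) (2 * e - 1)
    have k₂ := hD e (2 * e - 1)
    rw [show (2 * e - 1) * (2 * e - 1) + (2 * e - 1) * (2 * e - 1) = 2 * 1 by
      linear_combination (norm := noncomm_ring) 8 * ee, D2] at k₁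
    rw [show e * (2 * e - 1) + (2 * e - 1) * e = 2 * e by
      linear_combination (norm := noncomm_ring) 4 * ee, two, De] at k₂
    refine h.eq_zero_of_two_mul _ (h.eq_zero_of_two_mul _ ?_)
    linear_combination (norm := noncomm_ring) k₁ - 4 * k₂
  have Dv : D (1 - 2 * e) = 0 := by
    have k₁ := hD (1 - 2 * e) (1 - 2 * e)
    have k₂ := hD (1 - e) (1 - 2 * e)
    rw [show (1 - 2 * e) * (1 - 2 * e) + (1 - 2 * e) * (1 - 2 * e) = 2 * 1 by
      linear_combination (norm := noncomm_ring) 8 * ee, D2] at k₁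
    rw [show (1 - e) * (1 - 2 * e) + (1 - 2 * e) * (1 - e) = 2 * (1 - e) by
      linear_combination (norm := noncomm_ring) 4 * ee, two, Df] at k₂
    refine h.eq_zero_of_two_mul _ (h.eq_zero_of_two_mul _ ?_)
    linear_combination (norm := noncomm_ring) k₁ - 4 * k₂
  refine ⟨h.eq_of_two_mul (h.eq_of_two_mul ?_), h.eq_of_two_mul (h.eq_of_two_mul ?_), ?_⟩
  · rw [← two, ← two, show 2 * (2 * (e * x * e))
      = (e * x + x * e) * (2 * e - 1) + (2 * e - 1) * (e * x + x * e) by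
        linear_combination (norm := noncomm_ring) - 2 * (ee * x) - 2 * (x * ee), hD, hD, Du, De]
    linear_combination (norm := noncomm_ring) 2 * (ee * D x) + 2 * (D x * ee)
  · rw [← two, ← two, show 2 * (2 * ((1 - e) * x * (1 - e)))
      = ((1 - e) * x + x * (1 - e)) * (1 - 2 * e) + (1 - 2 * e) * ((1 - e) * x + x * (1 - e)) by
        linear_combination (norm := noncomm_ring) - 2 * (ee * x) - 2 * (x * ee), hD, hD, Dv, Df]
    linear_combination (norm := noncomm_ring) 2 * (ee * D x) + 2 * (D x * ee)
  · rw [show e * x * (1 - e) + (1 - e) * x * e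
      = e * ((1 - e) * x + x * (1 - e)) + ((1 - e) * x + x * (1 - e)) * e by
        linear_combination (norm := noncomm_ring) ee * x + x * ee, hD, hD, De, Df]
    linear_combination (norm := noncomm_ring) - (ee * D x) - (D x * ee)

theorem map_add_of_peirce (D1 : D 1 = 0) {a b w : A} (a₁ : e * a = a) (a₂ : a * e = a)
    (b₁ : e * b = 0) (b₂ : b * e = 0) (hw : e * w + w * e = w) :
    D (a + b + w) = D a + D b + D w := by
  obtain ⟨k₁, k₂, k₃⟩ := h.map_peirce_of_jordan hD De D1 (a + b + w)
  have hewe : e * w * e = 0 := by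
    have := congrArg (fun z => e * z) hw
    simpa [mul_add, h.left_idem_assoc, mul_assoc] using this
  have c₁ : e * (a + b + w) * e = a := by simp [mul_add, add_mul, a₁, a₂, b₁, hewe]
  have c₂ : f * (a + b + w) * f = b := by
    simp only [h.mul_right_comp, h.mul_left_comp, mul_add, add_mul, sub_mul, a₁, a₂, b₁, b₂, hewe]
    linear_combination (norm := noncomm_ring) - hw
  have c₃ : e * (a + b + w) * f + f * (a + b + w) * e = w := by
    simp only [h.mul_right_comp, h.mul_left_comp, mul_add, add_mul, a₁, a₂, b₁, hewe]
    linear_combination (norm := noncomm_ring) hw + b₂ - hewe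
  rw [c₁] at k₁
  rw [c₂] at k₂
  rw [c₃] at k₃
  rw [k₁, k₂, k₃]
  simp only [h.mul_right_comp, h.mul_left_comp, sub_mul]
  abel

theorem map_add_offDiag_of_jordan (D1 : D 1 = 0) {v w : A} (hv : e * v + v * e = v)
    (hw : e * w + w * e = w) : D (v + w) = D v + D w := by
  have hDv := peirce_offDiag_of_jordan hD De hv
  have hDw := peirce_offDiag_of_jordan hD De hw
  have Df := h.map_compl_of_jordan hD De D1
  have hef : e * f = 0 := by rw [h.mul_right_comp, h.left_idem, sub_self]
  have hfe : f * e = 0 := by rw [h.mul_left_comp, h.left_idem, sub_self]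
  have D0 : D 0 = 0 := by simpa using hD 0 0
  have k₁ := h.map_add_of_peirce hD De D1 h.left_idem h.left_idem (mul_zero e) (zero_mul e) hv
  have k₂ := h.map_add_of_peirce hD De D1 (mul_zero e) (zero_mul e) hef hfe hw
  have k := hD (e + v) (f + w)
  rw [add_zero, De, D0, zero_add, zero_add] at k₁
  rw [zero_add, Df, D0, zero_add, zero_add] at k₂
  have hprod : (e + v) * (f + w) + (f + w) * (e + v) = v + w := by
    simp only [mul_add, add_mul, h.mul_right_comp, h.mul_left_comp, h.left_idem,
      h.offDiag_mul_offDiag hv hw, h.offDiag_mul_offDiag hw hv]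
    linear_combination (norm := noncomm_ring) hw - hv
  rw [k₁, k₂, hprod] at k
  simp only [mul_add, add_mul, h.mul_right_comp, h.mul_left_comp, h.offDiag_mul_offDiag hDv hw,
    h.offDiag_mul_offDiag hw hDv, h.offDiag_mul_offDiag hv hDw, h.offDiag_mul_offDiag hDw hv] at k
  linear_combination (norm := noncomm_ring) k + hDw - hDv

theorem map_add_left_of_jordan (D1 : D 1 = 0) {a b : A} (a₁ : e * a = a) (a₂ : a * e = a)
    (b₁ : e * b = b) (b₂ : b * e = b) : D (a + b) = D a + D b := by
  obtain ⟨p₁, p₂⟩ := h.peirce_left_of_jordan hD De D1 a₁ a₂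
  obtain ⟨q₁, q₂⟩ := h.peirce_left_of_jordan hD De D1 b₁ b₂
  obtain ⟨r₁, r₂⟩ := h.peirce_left_of_jordan hD De D1 (a := a + b) (by rw [mul_add, a₁, b₁])
    (by rw [add_mul, a₂, b₂])
  have ann {m z : A} (hm : m * e = 0) (hz : e * z = z) : m * z = 0 := by
    rw [← hz, ← mul_assoc, hm, zero_mul]
  rw [← sub_eq_zero]
  refine h.eq_zero_of_mul_offDiag (by simp only [mul_sub, mul_add, p₁, q₁, r₁])
    (by simp only [sub_mul, add_mul, p₂, q₂, r₂]) fun m m₁ m₂ => ?_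
  have k₁ := hD a m
  have k₂ := hD b m
  have k₃ := hD (a + b) m
  have k₄ := h.map_add_offDiag_of_jordan hD De D1 (v := a * m) (w := b * m)
    (by rw [← mul_assoc, a₁, mul_assoc, m₂, mul_zero, add_zero])
    (by rw [← mul_assoc, b₁, mul_assoc, m₂, mul_zero, add_zero])
  rw [ann m₂ a₁, ann m₂ p₁, add_zero, add_zero] at k₁
  rw [ann m₂ b₁, ann m₂ q₁, add_zero, add_zero] at k₂
  rw [mul_add m, ann m₂ r₁, ann m₂ a₁, ann m₂ b₁, add_zero, add_zero, add_zero, add_mul, k₄,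
    k₁, k₂] at k₃
  linear_combination (norm := noncomm_ring) - k₃

theorem map_add_right_of_jordan (D1 : D 1 = 0) {a b : A} (a₁ : e * a = 0) (a₂ : a * e = 0)
    (b₁ : e * b = 0) (b₂ : b * e = 0) : D (a + b) = D a + D b := by
  obtain ⟨p₁, p₂⟩ := h.peirce_right_of_jordan hD De a₁ a₂
  obtain ⟨q₁, q₂⟩ := h.peirce_right_of_jordan hD De b₁ b₂
  obtain ⟨r₁, r₂⟩ := h.peirce_right_of_jordan hD De (b := a + b)
    (by rw [mul_add, a₁, b₁, add_zero]) (by rw [add_mul, a₂, b₂, add_zero])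
  have ann {z m : A} (hz : z * e = 0) (hm : e * m = m) : z * m = 0 := by
    rw [← hm, ← mul_assoc, hz, zero_mul]
  rw [← sub_eq_zero]
  refine h.eq_zero_of_offDiag_mul (by simp only [mul_sub, mul_add, p₁, q₁, r₁]; simp)
    (by simp only [sub_mul, add_mul, p₂, q₂, r₂]; simp) fun m m₁ m₂ => ?_
  have k₁ := hD a m
  have k₂ := hD b m
  have k₃ := hD (a + b) m
  have k₄ := h.map_add_offDiag_of_jordan hD De D1 (v := m * a) (w := m * b)
    (by rw [← mul_assoc, m₁, mul_assoc, a₂, mul_zero, add_zero])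
    (by rw [← mul_assoc, m₁, mul_assoc, b₂, mul_zero, add_zero])
  rw [ann a₂ m₁, ann p₂ m₁, zero_add, zero_add] at k₁
  rw [ann b₂ m₁, ann q₂ m₁, zero_add, zero_add] at k₂
  rw [add_mul _ _ m, ann r₂ m₁, ann a₂ m₁, ann b₂ m₁, zero_add, zero_add, zero_add, mul_add, k₄,
    k₁, k₂] at k₃
  linear_combination (norm := noncomm_ring) - k₃

theorem map_add_of_jordan (D1 : D 1 = 0) (x y : A) : D (x + y) = D x + D y := by
  have ee := h.left_idem
  have ee' := h.left_idem_assoc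
  have sum (z : A) : D z = D (e * z * e) + D (f * z * f) + D (e * z * f + f * z * e) := by
    obtain ⟨k₁, k₂, k₃⟩ := h.map_peirce_of_jordan hD De D1 z
    rw [k₁, k₂, k₃]
    simp only [h.mul_right_comp, h.mul_left_comp, sub_mul]
    abel
  have l₁ (z : A) : e * (e * z * e) = e * z * e := by simp only [mul_assoc, ee']
  have l₂ (z : A) : e * z * e * e = e * z * e := by simp only [mul_assoc, ee]
  have r₁ (z : A) : e * (f * z * f) = 0 := by
    simp only [h.mul_right_comp, h.mul_left_comp, sub_mul, mul_sub, mul_assoc, ee', sub_self]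
  have r₂ (z : A) : f * z * f * e = 0 := by
    simp only [h.mul_right_comp, h.mul_left_comp, sub_mul, mul_assoc, ee, sub_self]
  have w₁ (z : A) : e * (e * z * f + f * z * e) + (e * z * f + f * z * e) * e
      = e * z * f + f * z * e := by
    simp only [h.mul_right_comp, h.mul_left_comp, sub_mul, mul_sub, add_mul, mul_add, mul_assoc,
      ee, ee']
    abel
  rw [sum (x + y), sum x, sum y, mul_add, mul_add, add_mul, add_mul, add_mul, add_mul,
    h.map_add_left_of_jordan hD De D1 (l₁ x) (l₂ x) (l₁ y) (l₂ y),
    h.map_add_right_of_jordan hD De D1 (r₁ x) (r₂ x) (r₁ y) (r₂ y), add_add_add_comm (e * x * f),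
    h.map_add_offDiag_of_jordan hD De D1 (w₁ x) (w₁ y)]
  abel

end JordanMap

end TrivialMoritaPair

/-- The Peirce components of `x` with respect to an idempotent `e` are `a ∈ eAe`,
`m ∈ eA(1 - e)`, `n ∈ (1 - e)Ae` and `b ∈ (1 - e)A(1 - e)`. -/
structure IsPeirceDecomp {A : Type*} [Ring A] (e x a m n b : A) : Prop where
  eq_add : x = a + m + n + b
  left_a : e * a = a
  right_a : a * e = a
  left_m : e * m = m
  right_m : m * e = 0
  left_n : e * n = 0
  right_n : n * e = n
  left_b : e * b = 0
  right_b : b * e = 0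

namespace IsPeirceDecomp

variable {A : Type*} [Ring A] {e x a m n b y a' m' n' b' : A}

theorem exists_of_idem (he : e * e = e) (x : A) : ∃ a m n b, IsPeirceDecomp e x a m n b := by
  have he' (z : A) : e * (e * z) = e * z := by rw [← mul_assoc, he]
  refine ⟨e * x * e, e * x - e * x * e, x * e - e * x * e, x - e * x - x * e + e * x * e,
    by abel, ?_, ?_, ?_, ?_, ?_, ?_, ?_, ?_⟩ <;>
  simp [mul_add, mul_sub, add_mul, sub_mul, mul_assoc, he, he']

theorem left (hx : IsPeirceDecomp e x a m n b) : e * x = a + m := by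
  simp [hx.eq_add, mul_add, hx.left_a, hx.left_m, hx.left_n, hx.left_b]

theorem right (hx : IsPeirceDecomp e x a m n b) : x * e = a + n := by
  simp [hx.eq_add, add_mul, hx.right_a, hx.right_m, hx.right_n, hx.right_b]

theorem corner (hx : IsPeirceDecomp e x a m n b) : e * x * e = a := by
  simp [hx.left, add_mul, hx.right_a, hx.right_m]

theorem add (hx : IsPeirceDecomp e x a m n b) (hy : IsPeirceDecomp e y a' m' n' b') :
    IsPeirceDecomp e (x + y) (a + a') (m + m') (n + n') (b + b') where
  eq_add := by rw [hx.eq_add, hy.eq_add]; abel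
  left_a := by rw [mul_add, hx.left_a, hy.left_a]
  right_a := by rw [add_mul, hx.right_a, hy.right_a]
  left_m := by rw [mul_add, hx.left_m, hy.left_m]
  right_m := by rw [add_mul, hx.right_m, hy.right_m, add_zero]
  left_n := by rw [mul_add, hx.left_n, hy.left_n, add_zero]
  right_n := by rw [add_mul, hx.right_n, hy.right_n]
  left_b := by rw [mul_add, hx.left_b, hy.left_b, add_zero]
  right_b := by rw [add_mul, hx.right_b, hy.right_b, add_zero]

theorem mul {f : A} (h : TrivialMoritaPair e f) (hx : IsPeirceDecomp e x a m n b)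
    (hy : IsPeirceDecomp e y a' m' n' b') :
    IsPeirceDecomp e (x * y) (a * a') (a * m' + m * b') (n * a' + b * n') (b * b') where
  eq_add := by
    have z₁ {u v : A} (hu : u * e = u) (hv : e * v = 0) : u * v = 0 := by
      rw [← hu, mul_assoc, hv, mul_zero]
    have z₂ {u v : A} (hu : u * e = 0) (hv : e * v = v) : u * v = 0 := by
      rw [← hv, ← mul_assoc, hu, zero_mul]
    have mW {u : A} (h₁ : e * u = u) (h₂ : u * e = 0) : e * u + u * e = u := by
      rw [h₁, h₂, add_zero]
    have nW {u : A} (h₁ : e * u = 0) (h₂ : u * e = u) : e * u + u * e = u := by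
      rw [h₁, h₂, zero_add]
    rw [hx.eq_add, hy.eq_add]
    simp only [mul_add, add_mul, z₁ hx.right_a hy.left_n, z₁ hx.right_a hy.left_b,
      z₁ hx.right_n hy.left_n, z₁ hx.right_n hy.left_b, z₂ hx.right_m hy.left_a,
      z₂ hx.right_m hy.left_m, z₂ hx.right_b hy.left_a, z₂ hx.right_b hy.left_m,
      h.offDiag_mul_offDiag (mW hx.left_m hx.right_m) (nW hy.left_n hy.right_n),
      h.offDiag_mul_offDiag (nW hx.left_n hx.right_n) (mW hy.left_m hy.right_m)]
    abel
  left_a := by rw [← mul_assoc, hx.left_a]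
  right_a := by rw [mul_assoc, hy.right_a]
  left_m := by rw [mul_add, ← mul_assoc, ← mul_assoc, hx.left_a, hx.left_m]
  right_m := by rw [add_mul, mul_assoc, mul_assoc, hy.right_m, hy.right_b]; simp
  left_n := by rw [mul_add, ← mul_assoc, ← mul_assoc, hx.left_n, hx.left_b]; simp
  right_n := by rw [add_mul, mul_assoc, mul_assoc, hy.right_a, hy.right_n]
  left_b := by rw [← mul_assoc, hx.left_b, zero_mul]
  right_b := by rw [mul_assoc, hy.right_b, mul_zero]

end IsPeirceDecomp

namespace TrivialMoritaPair

variable {A : Type*} [Ring A] {e f : A} (h : TrivialMoritaPair e f)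
include h

theorem exists_derivation_add_antiderivation {D : A → A}
    (hD : ∀ x y, D (x * y + y * x) = D x * y + y * D x + (x * D y + D y * x))
    (De : D e = 0) (D1 : D 1 = 0) :
    ∃ d φ : A → A, (∀ x y, d (x + y) = d x + d y) ∧ (∀ x y, d (x * y) = d x * y + x * d y) ∧
      (∀ x y, φ (x + y) = φ x + φ y) ∧ (∀ x y, φ (x * y) = φ y * x + y * φ x) ∧
      ∀ x, D x = d x + φ x := by
  have hadd := h.map_add_of_jordan hD De D1
  have z₁ {u v : A} (hu : u * e = u) (hv : e * v = 0) : u * v = 0 := by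
    rw [← hu, mul_assoc, hv, mul_zero]
  have z₂ {u v : A} (hu : u * e = 0) (hv : e * v = v) : u * v = 0 := by
    rw [← hv, ← mul_assoc, hu, zero_mul]
  have dA {a : A} (h₁ : e * a = a) (h₂ : a * e = a) := h.peirce_left_of_jordan hD De D1 h₁ h₂
  have dB {b : A} (h₁ : e * b = 0) (h₂ : b * e = 0) := h.peirce_right_of_jordan hD De h₁ h₂
  have dM {m : A} (h₁ : e * m = m) (h₂ : m * e = 0) : e * D m + D m * e = D m :=
    peirce_offDiag_of_jordan hD De (by rw [h₁, h₂, add_zero])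
  have dN {n : A} (h₁ : e * n = 0) (h₂ : n * e = n) : e * D n + D n * e = D n :=
    peirce_offDiag_of_jordan hD De (by rw [h₁, h₂, zero_add])
  have corner {w : A} (hw : e * w + w * e = w) : e * w * e = 0 := by
    have := congrArg (fun z => e * z) hw
    simpa [mul_add, h.left_idem_assoc, mul_assoc] using this
  have amL {a m : A} (a₁ : e * a = a) (a₂ : a * e = a) (m₁ : e * m = m) (m₂ : m * e = 0) :
      e * D (a * m) = D a * m + a * (e * D m) ∧ D (a * m) * e = D m * e * a := by
    have k := hD a m
    have hc := corner (dM m₁ m₂)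
    rw [z₂ m₂ a₁, z₂ m₂ (dA a₁ a₂).1, add_zero, add_zero] at k
    have c₁ : e * (D m * a) = 0 := by rw [← a₁, ← mul_assoc, ← mul_assoc, hc, zero_mul]
    have c₂ : a * (D m * e) = 0 := by rw [← a₂, mul_assoc, ← mul_assoc e, hc, mul_zero]
    constructor
    · rw [k, mul_add, mul_add, c₁, add_zero, ← mul_assoc, ← mul_assoc, (dA a₁ a₂).1, a₁,
        ← mul_assoc a e, a₂]
    · rw [k, add_mul, add_mul, mul_assoc _ m, m₂, mul_zero, zero_add, mul_assoc a, c₂, zero_add,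
        mul_assoc, a₂, mul_assoc, a₁]
  have mbL {m b : A} (m₁ : e * m = m) (m₂ : m * e = 0) (b₁ : e * b = 0) (b₂ : b * e = 0) :
      e * D (m * b) = e * D m * b + m * D b ∧ D (m * b) * e = b * (D m * e) := by
    have k := hD m b
    rw [z₂ b₂ m₁, z₂ (dB b₁ b₂).2 m₁, add_zero, add_zero] at k
    have c₁ : D m * b = e * D m * b := by
      conv_lhs => rw [← dM m₁ m₂, add_mul, mul_assoc _ e, b₁, mul_zero, add_zero]
    constructor
    · rw [k, mul_add, mul_add, ← mul_assoc e b, b₁, zero_mul, add_zero, ← mul_assoc e m, m₁,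
        mul_assoc]
    · rw [k, add_mul, add_mul, mul_assoc _ b, b₂, mul_zero, zero_add, mul_assoc m, (dB b₁ b₂).2,
        mul_zero, add_zero, mul_assoc]
  have naL {n a : A} (n₁ : e * n = 0) (n₂ : n * e = n) (a₁ : e * a = a) (a₂ : a * e = a) :
      D (n * a) * e = D n * e * a + n * D a ∧ e * D (n * a) = a * (e * D n) := by
    have k := hD n a
    have hc := corner (dN n₁ n₂)
    rw [z₁ a₂ n₁, z₁ (dA a₁ a₂).2 n₁, add_zero, add_zero] at k
    have c₁ : e * (D n * a) = 0 := by rw [← a₁, ← mul_assoc, ← mul_assoc, hc, zero_mul]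
    have c₂ : a * (D n * e) = 0 := by rw [← a₂, mul_assoc, ← mul_assoc e, hc, mul_zero]
    constructor
    · rw [k, add_mul, add_mul, mul_assoc a, c₂, add_zero, mul_assoc n, (dA a₁ a₂).2, mul_assoc,
        a₂, mul_assoc, a₁]
    · rw [k, mul_add, mul_add, c₁, zero_add, ← mul_assoc e n, n₁, zero_mul, add_zero,
        ← mul_assoc e a, a₁, ← mul_assoc a, a₂]
  have bnL {b n : A} (b₁ : e * b = 0) (b₂ : b * e = 0) (n₁ : e * n = 0) (n₂ : n * e = n) :
      D (b * n) * e = D b * n + b * (D n * e) ∧ e * D (b * n) = e * D n * b := by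
    have k := hD b n
    rw [z₁ n₂ b₁, z₁ n₂ (dB b₁ b₂).1, add_zero, add_zero] at k
    constructor
    · rw [k, add_mul, add_mul, mul_assoc _ n, n₂, mul_assoc b, mul_assoc _ b, b₂, mul_zero,
        add_zero]
    · rw [k, mul_add, mul_add, ← mul_assoc e b, b₁, zero_mul, zero_add, ← mul_assoc e (D b),
        (dB b₁ b₂).1, zero_mul, zero_add, mul_assoc]
  have aa {a b : A} (a₁ : e * a = a) (a₂ : a * e = a) (b₁ : e * b = b) (b₂ : b * e = b) :
      D (a * b) = D a * b + a * D b := by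
    have ab₁ : e * (a * b) = a * b := by rw [← mul_assoc, a₁]
    have ab₂ : a * b * e = a * b := by rw [mul_assoc, b₂]
    rw [← sub_eq_zero]
    refine h.eq_zero_of_mul_offDiag ?_ ?_ fun m m₁ m₂ => ?_
    · rw [mul_sub, mul_add, ← mul_assoc, ← mul_assoc, (dA a₁ a₂).1, a₁, (dA ab₁ ab₂).1]
    · rw [sub_mul, add_mul, mul_assoc, mul_assoc, (dA b₁ b₂).2, b₂, (dA ab₁ ab₂).2]
    · have k₁ := (amL ab₁ ab₂ m₁ m₂).1
      have k₂ := (amL (m := b * m) a₁ a₂ (by rw [← mul_assoc, b₁])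
        (by rw [mul_assoc, m₂, mul_zero])).1
      have k₃ := (amL b₁ b₂ m₁ m₂).1
      rw [mul_assoc, k₂, k₃] at k₁
      linear_combination (norm := noncomm_ring) - k₁
  have bb {a b : A} (a₁ : e * a = 0) (a₂ : a * e = 0) (b₁ : e * b = 0) (b₂ : b * e = 0) :
      D (a * b) = D a * b + a * D b := by
    have ab₁ : e * (a * b) = 0 := by rw [← mul_assoc, a₁, zero_mul]
    have ab₂ : a * b * e = 0 := by rw [mul_assoc, b₂, mul_zero]
    rw [← sub_eq_zero]
    refine h.eq_zero_of_offDiag_mul ?_ ?_ fun m m₁ m₂ => ?_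
    · rw [mul_sub, mul_add, ← mul_assoc, ← mul_assoc, (dB a₁ a₂).1, a₁, (dB ab₁ ab₂).1]; simp
    · rw [sub_mul, add_mul, mul_assoc, mul_assoc, (dB b₁ b₂).2, b₂, (dB ab₁ ab₂).2]; simp
    · have k₁ := (mbL m₁ m₂ ab₁ ab₂).1
      have k₂ := (mbL (m := m * a) (by rw [← mul_assoc, m₁])
        (by rw [mul_assoc, a₂, mul_zero]) b₁ b₂).1
      have k₃ := (mbL m₁ m₂ a₁ a₂).1
      rw [← mul_assoc, k₂, k₃] at k₁
      linear_combination (norm := noncomm_ring) - k₁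
  obtain ⟨φ, hφ⟩ : ∃ φ : A → A, ∀ {x a m n b : A}, IsPeirceDecomp e x a m n b →
      φ x = D m * e + e * D n := by
    refine ⟨fun x => D (e * x - e * x * e) * e + e * D (x * e - e * x * e), fun hx => ?_⟩
    simp only [hx.corner]
    simp only [hx.left, hx.right, add_sub_cancel_left]
  have hφ' {x a m n b : A} (hx : IsPeirceDecomp e x a m n b) :
      IsPeirceDecomp e (φ x) 0 (e * D n) (D m * e) 0 := by
    refine ⟨by rw [hφ hx]; abel, mul_zero e, zero_mul e, h.left_idem_assoc _,
      corner (dN hx.left_n hx.right_n), ?_, ?_, mul_zero e, zero_mul e⟩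
    · rw [← mul_assoc, corner (dM hx.left_m hx.right_m)]
    · rw [mul_assoc, h.left_idem]
  have hd {x a m n b : A} (hx : IsPeirceDecomp e x a m n b) :
      IsPeirceDecomp e (D x - φ x) (D a) (e * D m) (D n * e) (D b) := by
    refine ⟨?_, (dA hx.left_a hx.right_a).1, (dA hx.left_a hx.right_a).2, h.left_idem_assoc _,
      corner (dM hx.left_m hx.right_m), ?_, ?_, (dB hx.left_b hx.right_b).1,
      (dB hx.left_b hx.right_b).2⟩
    · rw [hφ hx, hx.eq_add, hadd, hadd, hadd]
      linear_combination (norm := noncomm_ring)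
        - dM hx.left_m hx.right_m - dN hx.left_n hx.right_n
    · rw [← mul_assoc, corner (dN hx.left_n hx.right_n)]
    · rw [mul_assoc, h.left_idem]
  have φadd (x y : A) : φ (x + y) = φ x + φ y := by
    obtain ⟨a, m, n, b, hx⟩ := IsPeirceDecomp.exists_of_idem h.left_idem x
    obtain ⟨a', m', n', b', hy⟩ := IsPeirceDecomp.exists_of_idem h.left_idem y
    rw [hφ hx, hφ hy, hφ (hx.add hy), hadd, hadd]
    noncomm_ring
  refine ⟨fun x => D x - φ x, φ, fun x y => ?_, fun x y => ?_, φadd, fun x y => ?_,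
    fun x => (sub_add_cancel _ _).symm⟩
  · simp only [hadd, φadd]
    abel
  all_goals
    obtain ⟨a, m, n, b, hx⟩ := IsPeirceDecomp.exists_of_idem h.left_idem x
    obtain ⟨a', m', n', b', hy⟩ := IsPeirceDecomp.exists_of_idem h.left_idem y
    have hxy := hx.mul h hy
  · beta_reduce
    rw [(hd hxy).eq_add, ((hd hx).mul h hy).eq_add, (hx.mul h (hd hy)).eq_add, hadd, hadd,
      aa hx.left_a hx.right_a hy.left_a hy.right_a, bb hx.left_b hx.right_b hy.left_b hy.right_b,
      mul_add e, add_mul _ _ e, (amL hx.left_a hx.right_a hy.left_m hy.right_m).1,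
      (mbL hx.left_m hx.right_m hy.left_b hy.right_b).1,
      (naL hx.left_n hx.right_n hy.left_a hy.right_a).1,
      (bnL hx.left_b hx.right_b hy.left_n hy.right_n).1]
    abel
  · rw [(hφ' hxy).eq_add, ((hφ' hy).mul h hx).eq_add, (hy.mul h (hφ' hx)).eq_add, hadd, hadd,
      mul_add e, add_mul _ _ e, (amL hx.left_a hx.right_a hy.left_m hy.right_m).2,
      (mbL hx.left_m hx.right_m hy.left_b hy.right_b).2,
      (naL hx.left_n hx.right_n hy.left_a hy.right_a).2,
      (bnL hx.left_b hx.right_b hy.left_n hy.right_n).2]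
    simp only [mul_zero, zero_mul, add_zero, zero_add]
    abel

theorem exists_derivation_add_antiderivation_of_jordan {D : A → A}
    (hD : ∀ x y, D (x * y + y * x) = D x * y + y * D x + (x * D y + D y * x)) (D1 : D 1 = 0) :
    ∃ d φ : A → A, (∀ x y, d (x + y) = d x + d y) ∧ (∀ x y, d (x * y) = d x * y + x * d y) ∧
      (∀ x y, φ (x + y) = φ x + φ y) ∧ (∀ x y, φ (x * y) = φ y * x + y * φ x) ∧
      ∀ x, D x = d x + φ x := by
  obtain ⟨w, hw⟩ := h.exists_map_sub_commutator_eq_zero hD D1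
  obtain ⟨d, φ, hd, hd', hφ, hφ', hdφ⟩ := h.exists_derivation_add_antiderivation
    (D := fun x => D x - (x * w - w * x))
    (fun x y => by rw [hD]; noncomm_ring) hw (by simp [D1])
  refine ⟨fun x => d x + (x * w - w * x), φ, fun x y => ?_, fun x y => ?_, hφ, hφ', fun x => ?_⟩
  · beta_reduce; rw [hd]; noncomm_ring
  · beta_reduce; rw [hd']; noncomm_ring
  · linear_combination (norm := noncomm_ring) hdφ x

end TrivialMoritaPair

/-- On a 2-torsion-free unital ring with a nontrivial idempotent `e₁` (writing
`e₂ = 1 - e₁`) such that `e₁Ae₂·e₂Ae₁ = {0} = e₂Ae₁·e₁Ae₂` and `e₁Ae₂` is a faithful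
left `e₁Ae₁`-module and a faithful right `e₂Ae₂`-module, every multiplicative
generalized Jordan `n`-derivation has the form `Δ(t) = μt + d(t) + φ(t)` with `μ`
central, `d` a derivation and `φ` an antiderivation. -/
theorem stmt_5 {A : Type*} [Ring A] (n : ℕ) (hn : 2 ≤ n)
    (h2 : ∀ t : A, 2 * t = 0 → t = 0)
    (e₁ : A) (hidem : e₁ * e₁ = e₁) (he0 : e₁ ≠ 0) (he1 : e₁ ≠ 1)
    (horth₁ : ∀ a b : A, (e₁ * a * (1 - e₁)) * ((1 - e₁) * b * e₁) = 0)
    (horth₂ : ∀ a b : A, ((1 - e₁) * a * e₁) * (e₁ * b * (1 - e₁)) = 0)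
    (hfaithL : ∀ t : A, (∀ a : A, e₁ * t * e₁ * (e₁ * a * (1 - e₁)) = 0) →
      e₁ * t * e₁ = 0)
    (hfaithR : ∀ t : A, (∀ a : A, (e₁ * a * (1 - e₁)) * ((1 - e₁) * t * (1 - e₁)) = 0) →
      (1 - e₁) * t * (1 - e₁) = 0)
    (Δ δ₀ : A → A) (hδ₀ : IsMulJordanDeriv n δ₀) (hΔ : IsMulGenJordanDeriv n Δ δ₀) :
    ∃ μ : A, ∃ d φ : A → A,
      (∀ a : A, μ * a = a * μ) ∧
      (∀ x y : A, d (x + y) = d x + d y) ∧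
      (∀ x y : A, d (x * y) = d x * y + x * d y) ∧
      (∀ x y : A, φ (x + y) = φ x + φ y) ∧
      (∀ x y : A, φ (x * y) = φ y * x + y * φ x) ∧
      ∀ t : A, Δ t = μ * t + d t + φ t := by
  have h : TrivialMoritaPair e₁ (1 - e₁) :=
    ⟨h2, add_sub_cancel _ _, hidem, horth₁, horth₂, hfaithL, hfaithR⟩
  obtain ⟨k, rfl⟩ := Nat.exists_eq_add_of_le' hn
  obtain ⟨s, hs, hΔs⟩ := h.exists_central_of_isMulGenJordanDeriv hΔ hδ₀
  obtain ⟨c, hc, D, D1, hδD, hD⟩ := h.exists_central_of_isMulJordanDeriv hδ₀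
  obtain ⟨d, φ, hd, hd', hφ, hφ', hdφ⟩ := h.exists_derivation_add_antiderivation_of_jordan hD D1
  refine ⟨s + c, d, φ, fun a => by rw [add_mul, mul_add, hs, hc], hd, hd', hφ, hφ', fun t => ?_⟩
  rw [hΔs, hδD, hdφ]
  noncomm_ring
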